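/- arXiv:math/0411075 — 5 statements merged into one kernel-verified Lean document; each statement's English description precedes it below -/
import Mathlib

section
/- Let A be a group, C a subgroup of A, and φ : A → A a group automorphism of A. Let D = A ∗_{C = φ(C)} A be the amalgamated free product of two copies of A, amalgamating the subgroup C in the first copy with its image φ(C) in the second copy via φ. Then there exists a group homomorphism ψ : D → A such that (i) ψ restricted to the canonical image of the first copy of A in D is the identity (in particular injective), (ii) ψ restricted to the canonical image of the second copy of A in D equals φ⁻¹ (in particular injective), and (iii) the kernel of ψ is the subgroup of D generated by the elements a·(φ(a))⁻¹, where a ranges over the first copy of A and φ(a) denotes the corresponding element of the second copy. -/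
open scoped Pointwise

/-- The two maps `C →* A` defining the double `D = A ∗_{C = φ(C)} A`: the first copy of `A`
receives `C` by inclusion, the second copy receives `C` via `φ` followed by inclusion. -/
def doubleMaps {A : Type*} [Group A] (C : Subgroup A) (φ : A ≃* A) :
    Bool → (↥C →* A) :=
  fun b => match b with
  | false => C.subtype
  | true => (φ : A →* A).comp C.subtype

/-- The double `A ∗_{C = φ(C)} A`: the amalgamated free product (pushout) of two copies of `A`
over `C`, amalgamating `C` in the first copy with `φ(C)` in the second copy via `φ`. -/
abbrev Double {A : Type*} [Group A] (C : Subgroup A) (φ : A ≃* A) : Type _ :=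
  Monoid.PushoutI (doubleMaps C φ)

/-- The canonical embedding of the first copy of `A` into the double. -/
def Double.inl {A : Type*} [Group A] (C : Subgroup A) (φ : A ≃* A) : A →* Double C φ :=
  Monoid.PushoutI.of (φ := doubleMaps C φ) false

/-- The canonical embedding of the second copy of `A` into the double. -/
def Double.inr {A : Type*} [Group A] (C : Subgroup A) (φ : A ≃* A) : A →* Double C φ :=
  Monoid.PushoutI.of (φ := doubleMaps C φ) true

/-- A group is residually solvable if every nontrivial element survives in some solvable
homomorphic image. -/
def ResiduallySolvable (G : Type u) [Group G] : Prop :=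
  ∀ g : G, g ≠ 1 → ∃ (S : Type u) (_ : Group S) (f : G →* S), IsSolvable S ∧ f g ≠ 1

/-- Conjugation by the first copy of `A` preserves the subgroup generated by the elements
`a·(φ a)⁻¹`. -/
lemma Double.conj_inl_mem_closure {A : Type*} [Group A] (C : Subgroup A) (φ : A ≃* A) (b : A)
    {k : Double C φ}
    (hk : k ∈ Subgroup.closure
      {x : Double C φ | ∃ a : A, x = Double.inl C φ a * (Double.inr C φ (φ a))⁻¹}) :
    Double.inl C φ b * k * (Double.inl C φ b)⁻¹ ∈ Subgroup.closure
      {x : Double C φ | ∃ a : A, x = Double.inl C φ a * (Double.inr C φ (φ a))⁻¹} := by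
  induction hk using Subgroup.closure_induction with
  | mem x hx =>
    obtain ⟨a, rfl⟩ := hx
    have h : Double.inl C φ b * (Double.inl C φ a * (Double.inr C φ (φ a))⁻¹) *
          (Double.inl C φ b)⁻¹ =
        Double.inl C φ (b * a) * (Double.inr C φ (φ (b * a)))⁻¹ *
          (Double.inl C φ b * (Double.inr C φ (φ b))⁻¹)⁻¹ := by
      simp only [map_mul]
      group
    rw [h]
    exact mul_mem (Subgroup.subset_closure ⟨b * a, rfl⟩)
      (inv_mem (Subgroup.subset_closure ⟨b, rfl⟩))
  | one => simp
  | mul x y _ _ hx hy => simpa [mul_assoc] using mul_mem hx hy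
  | inv x _ hx => simpa [mul_assoc] using inv_mem hx

/-- The retraction of the double onto its first factor, equal to `φ⁻¹` on the second factor. -/
def Double.retraction {A : Type*} [Group A] (C : Subgroup A) (φ : A ≃* A) : Double C φ →* A :=
  Monoid.PushoutI.lift
    (fun b => match b with
      | false => MonoidHom.id A
      | true => (φ.symm : A →* A))
    C.subtype (by
      rintro (_ | _)
      · rfl
      · ext c
        exact φ.symm_apply_apply c)

lemma Double.retraction_inl {A : Type*} [Group A] (C : Subgroup A) (φ : A ≃* A) (a : A) :
    Double.retraction C φ (Double.inl C φ a) = a :=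
  Monoid.PushoutI.lift_of _ _ _ _

lemma Double.retraction_inr {A : Type*} [Group A] (C : Subgroup A) (φ : A ≃* A) (a : A) :
    Double.retraction C φ (Double.inr C φ a) = φ.symm a :=
  Monoid.PushoutI.lift_of _ _ _ _

/-- Every element `d` of the double is congruent to its retraction modulo the subgroup generated
by the elements `a·(φ a)⁻¹`. -/
lemma Double.mul_inv_inl_retraction_mem_closure {A : Type*} [Group A] (C : Subgroup A)
    (φ : A ≃* A) (d : Double C φ) :
    d * (Double.inl C φ (Double.retraction C φ d))⁻¹ ∈ Subgroup.closure
      {x : Double C φ | ∃ a : A, x = Double.inl C φ a * (Double.inr C φ (φ a))⁻¹} := by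
  have h_inl (a : A) : Double.inl C φ a *
      (Double.inl C φ (Double.retraction C φ (Double.inl C φ a)))⁻¹ ∈ Subgroup.closure
      {x : Double C φ | ∃ a : A, x = Double.inl C φ a * (Double.inr C φ (φ a))⁻¹} := by
    simp [Double.retraction_inl]
  induction d using Monoid.PushoutI.induction_on with
  | of i a =>
    cases i with
    | false => exact h_inl a
    | true =>
      change Double.inr C φ a *
        (Double.inl C φ (Double.retraction C φ (Double.inr C φ a)))⁻¹ ∈ _
      rw [Double.retraction_inr, ← inv_mem_iff]
      exact Subgroup.subset_closure ⟨φ.symm a, by simp⟩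
  | base c =>
    rw [← Monoid.PushoutI.of_apply_eq_base (doubleMaps C φ) false c]
    exact h_inl c
  | mul x y hx hy =>
    have h := mul_mem hx
      (Double.conj_inl_mem_closure C φ (Double.retraction C φ x) hy)
    simpa [mul_assoc] using h

/-- **Lemma (double_key_lemma).** There is a homomorphism `ψ` from the double
`D = A ∗_{C = φ(C)} A` onto the factor `A` which is the identity on the first copy of `A`
(in particular injective there), equals `φ⁻¹` on the second copy (in particular injective
there), and whose kernel is the subgroup generated by the elements `a·(φ a)⁻¹`, `a` ranging
over the first copy of `A`. -/
theorem double_retraction {A : Type*} [Group A] (C : Subgroup A) (φ : A ≃* A) :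
    ∃ ψ : Double C φ →* A,
      (∀ a : A, ψ (Double.inl C φ a) = a) ∧
      Function.Injective (ψ.comp (Double.inl C φ)) ∧
      (∀ a : A, ψ (Double.inr C φ a) = φ.symm a) ∧
      Function.Injective (ψ.comp (Double.inr C φ)) ∧
      ψ.ker = Subgroup.closure
        {x : Double C φ | ∃ a : A, x = Double.inl C φ a * (Double.inr C φ (φ a))⁻¹} := by
  refine ⟨Double.retraction C φ, Double.retraction_inl C φ, ?_, Double.retraction_inr C φ, ?_,
    le_antisymm ?_ ?_⟩
  · intro a b h
    simpa [Double.retraction_inl] using h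
  · intro a b h
    simpa [Double.retraction_inr] using h
  · intro d hd
    simpa [MonoidHom.mem_ker.mp hd] using Double.mul_inv_inl_retraction_mem_closure C φ d
  · rw [Subgroup.closure_le]
    rintro _ ⟨a, rfl⟩
    simp [MonoidHom.mem_ker, Double.retraction_inl, Double.retraction_inr]
end

section
/- Let A be a group, C a proper subgroup of A, and φ : A → A a group automorphism. Let D = A ∗_{C = φ(C)} A be the double of A over C via φ, let ψ : D → A be the retraction homomorphism which is the identity on the first copy of A and equals φ⁻¹ on the second copy, and let K = ker ψ. Then K is not central in D; that is, the commutator subgroup [K, D] is nontrivial. -/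
open scoped Pointwise

theorem doubleMaps_injective {A : Type*} [Group A] (C : Subgroup A) (φ : A ≃* A) (b : Bool) :
    Function.Injective (doubleMaps C φ b) := by
  cases b with
  | false => exact C.subtype_injective
  | true => exact φ.injective.comp C.subtype_injective

theorem range_doubleMaps_false {A : Type*} [Group A] (C : Subgroup A) (φ : A ≃* A) :
    (doubleMaps C φ false).range = C :=
  C.range_subtype

theorem mem_range_doubleMaps_true {A : Type*} [Group A] (C : Subgroup A) (φ : A ≃* A) (a : A) :
    φ a ∈ (doubleMaps C φ true).range ↔ a ∈ C := by
  simp [doubleMaps, MonoidHom.mem_range]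

/-- In the double, elements of the two copies of `A` outside the amalgamated subgroup never
commute. -/
theorem Double.not_commute_inl_inr {A : Type*} [Group A] (C : Subgroup A) (φ : A ≃* A)
    {a b : A} (ha : a ∉ C) (hb : b ∉ C) :
    ¬ Commute (Double.inl C φ a) (Double.inr C φ (φ b)) := by
  intro h
  have ha1 : a ≠ 1 := fun h => ha (h ▸ C.one_mem)
  have hb1 : b ≠ 1 := fun h => hb (h ▸ C.one_mem)
  let w : Monoid.CoprodI.Word (fun _ : Bool => A) :=
    { toList := [⟨false, a⟩, ⟨true, φ b⟩, ⟨false, a⁻¹⟩, ⟨true, φ b⁻¹⟩]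
      ne_one := by simp [ha1, hb1]
      chain_ne := by simp }
  have hw : Monoid.PushoutI.Reduced (doubleMaps C φ) w := by
    simp only [Monoid.PushoutI.Reduced, w, List.forall_mem_cons, range_doubleMaps_false,
      mem_range_doubleMaps_true, inv_mem_iff]
    exact ⟨ha, hb, ha, hb, by simp⟩
  have hprod : Monoid.PushoutI.ofCoprodI (φ := doubleMaps C φ) w.prod = 1 := by
    have hc : Double.inl C φ a * (Double.inr C φ (φ b) *
        ((Double.inl C φ a)⁻¹ * (Double.inr C φ (φ b))⁻¹)) = 1 := by
      rw [← mul_assoc, h.eq]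
      group
    simpa [w, Monoid.CoprodI.Word.prod, Double.inl, Double.inr] using hc
  have hempty := hw.eq_empty_of_mem_range (doubleMaps_injective C φ)
    (hprod ▸ one_mem (Monoid.PushoutI.base (doubleMaps C φ)).range)
  simpa [w, Monoid.CoprodI.Word.empty] using congrArg Monoid.CoprodI.Word.toList hempty

/-- **Lemma (Not_central_K).** If `C` is a proper subgroup of `A` and `ψ` is the retraction of
the double `D = A ∗_{C = φ(C)} A` onto `A` (the identity on the first copy of `A`, `φ⁻¹` on
the second copy), then `K = ker ψ` is not central in `D`; that is, `[K, D] ≠ 1`. -/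
theorem double_kernel_not_central {A : Type*} [Group A] (C : Subgroup A) (hC : C ≠ ⊤)
    (φ : A ≃* A) (ψ : Double C φ →* A)
    (hinl : ∀ a : A, ψ (Double.inl C φ a) = a)
    (hinr : ∀ a : A, ψ (Double.inr C φ a) = φ.symm a) :
    ⁅ψ.ker, (⊤ : Subgroup (Double C φ))⁆ ≠ ⊥ := by
  intro hbot
  obtain ⟨a, ha⟩ : ∃ a, a ∉ C := by
    by_contra! h
    exact hC (C.eq_top_iff'.2 h)
  have hk : (Double.inl C φ a)⁻¹ * Double.inr C φ (φ a) ∈ ψ.ker := by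
    simp [MonoidHom.mem_ker, hinl, hinr]
  have hcomm : Commute ((Double.inl C φ a)⁻¹ * Double.inr C φ (φ a)) (Double.inl C φ a) := by
    rw [← commutatorElement_eq_one_iff_commute, ← Subgroup.mem_bot, ← hbot]
    exact Subgroup.commutator_mem_commutator hk (Subgroup.mem_top _)
  apply Double.not_commute_inl_inr C φ ha ha
  simpa using (Commute.refl (Double.inl C φ a)).mul_right hcomm.symm
end

section
/- Let A be a group, C a normal subgroup of A, and φ : A → A a group automorphism. Let D = A ∗_{C = φ(C)} A be the double of A over C via φ, let ψ : D → A be the retraction homomorphism which is the identity on the first copy of A and equals φ⁻¹ on the second copy, and let K = ker ψ. Then K commutes elementwise with the image of C in D; that is, [C, K] = 1 in D. -/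
open scoped Pointwise

/-- The amalgamation relation: `c` in the first copy equals `φ c` in the second copy. -/
theorem Double.inr_apply_eq_inl {A : Type*} [Group A] {C : Subgroup A} {φ : A ≃* A} {c : A}
    (hc : c ∈ C) : Double.inr C φ (φ c) = Double.inl C φ c :=
  (Monoid.PushoutI.of_apply_eq_base (doubleMaps C φ) true ⟨c, hc⟩).trans
    (Monoid.PushoutI.of_apply_eq_base (doubleMaps C φ) false ⟨c, hc⟩).symm

/-- The double acts by conjugation on the normal amalgamated subgroup through the retraction. -/
theorem Double.conj_inl_of_mem {A : Type*} [Group A] {C : Subgroup A} (hC : C.Normal)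
    {φ : A ≃* A} (ψ : Double C φ →* A)
    (hinl : ∀ a : A, ψ (Double.inl C φ a) = a)
    (hinr : ∀ a : A, ψ (Double.inr C φ a) = φ.symm a)
    (x : Double C φ) (c : A) (hc : c ∈ C) :
    x * Double.inl C φ c * x⁻¹ = Double.inl C φ (ψ x * c * (ψ x)⁻¹) := by
  have inl_case (a c : A) : Double.inl C φ a * Double.inl C φ c * (Double.inl C φ a)⁻¹ =
      Double.inl C φ (ψ (Double.inl C φ a) * c * (ψ (Double.inl C φ a))⁻¹) := by
    simp [hinl]
  induction x using Monoid.PushoutI.induction_on generalizing c with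
  | of i a =>
    cases i with
    | false => exact inl_case a c
    | true =>
      change Double.inr C φ a * _ * (Double.inr C φ a)⁻¹ =
        Double.inl C φ (ψ (Double.inr C φ a) * c * (ψ (Double.inr C φ a))⁻¹)
      rw [hinr, ← Double.inr_apply_eq_inl hc, ← Double.inr_apply_eq_inl (hC.conj_mem c hc _)]
      simp
  | base d =>
    rw [← Monoid.PushoutI.of_apply_eq_base (doubleMaps C φ) false d]
    exact inl_case _ c
  | mul x y ihx ihy =>
    calc x * y * Double.inl C φ c * (x * y)⁻¹
        = x * (y * Double.inl C φ c * y⁻¹) * x⁻¹ := by group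
      _ = _ := by
        rw [ihy c hc, ihx _ (hC.conj_mem c hc _), map_mul ψ]
        simp only [mul_inv_rev, mul_assoc]

/-- **Lemma (Normal_commute).** If `C` is a normal subgroup of `A` and `ψ` is the retraction of
the double `D = A ∗_{C = φ(C)} A` onto `A` (the identity on the first copy of `A`, `φ⁻¹` on
the second copy), then `K = ker ψ` commutes elementwise with the image of `C` in `D`;
that is, `[C, K] = 1`. -/
theorem double_kernel_commutes_with_normal_amalgam {A : Type*} [Group A] (C : Subgroup A)
    (hC : C.Normal) (φ : A ≃* A) (ψ : Double C φ →* A)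
    (hinl : ∀ a : A, ψ (Double.inl C φ a) = a)
    (hinr : ∀ a : A, ψ (Double.inr C φ a) = φ.symm a) :
    ⁅Subgroup.map (Double.inl C φ) C, ψ.ker⁆ = ⊥ := by
  rw [eq_bot_iff, Subgroup.commutator_le]
  rintro _ ⟨c, hc, rfl⟩ x hx
  have h := Double.conj_inl_of_mem hC ψ hinl hinr x c hc
  rw [MonoidHom.mem_ker.mp hx, one_mul, inv_one, mul_one, mul_inv_eq_iff_eq_mul] at h
  rw [Subgroup.mem_bot, commutatorElement_eq_one_iff_mul_comm, h]
end

section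
/- Let A be a group, C a subgroup of A, and φ : A → A a group automorphism. Let D = A ∗_{C = φ(C)} A be the double of A over C via φ, let ψ : D → A be the retraction homomorphism which is the identity on the first copy of A and equals φ⁻¹ on the second copy, and let K = ker ψ. Then K is a free group. -/
open scoped Pointwise

noncomputable section

namespace Double

variable {A : Type*} [Group A] (C : Subgroup A)

/-- The free group on the pointed set `A ⧸ C`: the free group on the nontrivial left cosets. -/
abbrev CosetFreeGroup : Type _ :=
  FreeGroup {x : A ⧸ C // x ≠ ((1 : A) : A ⧸ C)}

open Classical in
/-- The generator attached to a left coset, where the trivial coset goes to `1`. -/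
def cosetGen (x : A ⧸ C) : CosetFreeGroup C :=
  if h : x = ((1 : A) : A ⧸ C) then 1 else FreeGroup.of ⟨x, h⟩

lemma cosetGen_one : cosetGen C ((1 : A) : A ⧸ C) = 1 := by
  simp [cosetGen]

lemma cosetGen_coe (x : {x : A ⧸ C // x ≠ ((1 : A) : A ⧸ C)}) :
    cosetGen C x = FreeGroup.of x := by
  simp [cosetGen, x.2]

variable {C}

/-- The homomorphism out of `CosetFreeGroup C` with prescribed values on the generators. -/
def cosetLift {G : Type*} [Group G] (f : A ⧸ C → G) : CosetFreeGroup C →* G :=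
  FreeGroup.lift fun x => f x

lemma cosetLift_cosetGen {G : Type*} [Group G] {f : A ⧸ C → G}
    (hf : f ((1 : A) : A ⧸ C) = 1) (x : A ⧸ C) : cosetLift f (cosetGen C x) = f x := by
  by_cases h : x = ((1 : A) : A ⧸ C)
  · rw [h, cosetGen_one, map_one, hf]
  · rw [cosetGen_coe C ⟨x, h⟩]
    exact FreeGroup.lift_apply_of

lemma cosetFreeGroup_hom_ext {G : Type*} [Group G] {f g : CosetFreeGroup C →* G}
    (h : ∀ a : A, f (cosetGen C a) = g (cosetGen C a)) : f = g := by
  ext x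
  rw [← cosetGen_coe]
  obtain ⟨a, ha⟩ := QuotientGroup.mk_surjective x.1
  rw [← ha]
  exact h a

variable (C)

/-- The endomorphism of `CosetFreeGroup C` by which `b : A` acts. -/
def cosetEnd (b : A) : CosetFreeGroup C →* CosetFreeGroup C :=
  cosetLift fun x => cosetGen C (b • x) * (cosetGen C (b : A ⧸ C))⁻¹

lemma cosetEnd_cosetGen (b a : A) :
    cosetEnd C b (cosetGen C a) =
      cosetGen C ((b * a : A) : A ⧸ C) * (cosetGen C (b : A ⧸ C))⁻¹ := by
  rw [cosetEnd, cosetLift_cosetGen]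
  · rfl
  · rw [MulAction.Quotient.smul_coe, smul_eq_mul, mul_one, mul_inv_cancel]

lemma cosetEnd_one : cosetEnd C 1 = MonoidHom.id _ :=
  cosetFreeGroup_hom_ext fun a => by simp [cosetEnd_cosetGen, cosetGen_one]

lemma cosetEnd_mul (b c : A) : cosetEnd C (b * c) = (cosetEnd C b).comp (cosetEnd C c) :=
  cosetFreeGroup_hom_ext fun a => by simp [cosetEnd_cosetGen, mul_assoc]

/-- The action of `A` on `CosetFreeGroup C`, determined by `b • [a] = [b * a] * [b]⁻¹`. -/
def cosetAut : A →* MulAut (CosetFreeGroup C) where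
  toFun b := MonoidHom.toMulEquiv (cosetEnd C b) (cosetEnd C b⁻¹)
    (by rw [← cosetEnd_mul, inv_mul_cancel, cosetEnd_one])
    (by rw [← cosetEnd_mul, mul_inv_cancel, cosetEnd_one])
  map_one' := MulEquiv.ext fun x => DFunLike.congr_fun (cosetEnd_one C) x
  map_mul' b c := MulEquiv.ext fun x => DFunLike.congr_fun (cosetEnd_mul C b c) x

lemma cosetAut_cosetGen (b a : A) :
    cosetAut C b (cosetGen C a) =
      cosetGen C ((b * a : A) : A ⧸ C) * (cosetGen C (b : A ⧸ C))⁻¹ :=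
  cosetEnd_cosetGen C b a

/-- The section `a ↦ ([a]⁻¹, a)` of the semidirect product, the image of the second copy of `A`. -/
def twistedInr : A →* CosetFreeGroup C ⋊[cosetAut C] A where
  toFun a := ⟨(cosetGen C (a : A ⧸ C))⁻¹, a⟩
  map_one' := by
    ext
    · simp [cosetGen_one]
    · rfl
  map_mul' a b := by
    ext
    · simp [cosetAut_cosetGen]
    · rfl

lemma twistedInr_apply (a : A) :
    twistedInr C a = SemidirectProduct.inl (cosetGen C (a : A ⧸ C))⁻¹ * SemidirectProduct.inr a :=
  SemidirectProduct.mk_eq_inl_mul_inr _ _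

variable (φ : A ≃* A)

lemma inl_coe (c : C) : inl C φ c = inr C φ (φ c) :=
  (Monoid.PushoutI.of_apply_eq_base (doubleMaps C φ) false c).trans
    (Monoid.PushoutI.of_apply_eq_base (doubleMaps C φ) true c).symm

variable {C φ} in
lemma hom_ext {G : Type*} [Group G] {f g : Double C φ →* G}
    (hl : ∀ a, f (inl C φ a) = g (inl C φ a))
    (hr : ∀ a, f (inr C φ (φ a)) = g (inr C φ (φ a))) : f = g := by
  refine Monoid.PushoutI.hom_ext_nonempty fun b => MonoidHom.ext fun a => ?_
  cases b
  · exact hl a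
  · obtain ⟨a, rfl⟩ := φ.surjective a
    exact hr a

/-- The homomorphism from the double to the semidirect product. -/
def toSemidirect : Double C φ →* CosetFreeGroup C ⋊[cosetAut C] A :=
  Monoid.PushoutI.lift
    (fun b => match b with
      | false => SemidirectProduct.inr
      | true => (twistedInr C).comp (φ.symm : A →* A))
    (SemidirectProduct.inr.comp C.subtype)
    (by
      rintro (_ | _)
      · rfl
      · refine MonoidHom.ext fun c => ?_
        have hc : (((c : A) : A ⧸ C)) = ((1 : A) : A ⧸ C) := by
          simp [QuotientGroup.eq]
        simp [doubleMaps, twistedInr_apply, hc, cosetGen_one])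

lemma toSemidirect_inl (a : A) : toSemidirect C φ (inl C φ a) = SemidirectProduct.inr a :=
  Monoid.PushoutI.lift_of ..

lemma toSemidirect_inr (a : A) : toSemidirect C φ (inr C φ (φ a)) = twistedInr C a := by
  refine (Monoid.PushoutI.lift_of ..).trans ?_
  simp

/-- The element `a * (φ a)⁻¹` of the double, with `a` in the first copy of `A` and `φ a` in the
second one; it depends only on the left coset of `a`. -/
def kerGen (x : A ⧸ C) : Double C φ :=
  Quotient.liftOn' x (fun a => inl C φ a * (inr C φ (φ a))⁻¹) fun a b h => by
    obtain ⟨c, rfl⟩ : ∃ c : C, b = a * c :=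
      ⟨⟨a⁻¹ * b, QuotientGroup.leftRel_apply.mp h⟩, by simp⟩
    simp [inl_coe]

lemma kerGen_coe (a : A) : kerGen C φ (a : A ⧸ C) = inl C φ a * (inr C φ (φ a))⁻¹ := rfl

lemma cosetLift_kerGen (a : A) :
    cosetLift (kerGen C φ) (cosetGen C (a : A ⧸ C)) = inl C φ a * (inr C φ (φ a))⁻¹ :=
  cosetLift_cosetGen (by simp [kerGen_coe]) _

/-- The homomorphism from the semidirect product to the double. -/
def ofSemidirect : CosetFreeGroup C ⋊[cosetAut C] A →* Double C φ :=
  SemidirectProduct.lift (cosetLift (kerGen C φ)) (inl C φ) fun b =>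
    cosetFreeGroup_hom_ext fun a => by
      simp [cosetAut_cosetGen, cosetLift_kerGen, mul_assoc]

lemma ofSemidirect_comp_toSemidirect :
    (ofSemidirect C φ).comp (toSemidirect C φ) = MonoidHom.id _ := by
  apply hom_ext <;> intro a
  · simp [toSemidirect_inl, ofSemidirect]
  · simp [toSemidirect_inr, ofSemidirect, twistedInr_apply, cosetLift_kerGen]

lemma toSemidirect_comp_ofSemidirect :
    (toSemidirect C φ).comp (ofSemidirect C φ) = MonoidHom.id _ := by
  refine SemidirectProduct.hom_ext (cosetFreeGroup_hom_ext fun a => ?_) (MonoidHom.ext fun a => ?_)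
  · simp [toSemidirect_inl, toSemidirect_inr, ofSemidirect, twistedInr_apply, cosetLift_kerGen]
  · simp [toSemidirect_inl, ofSemidirect]

/-- The double is the semidirect product of the free group on the nontrivial left cosets of `C`
by `A`. -/
def equivSemidirect : Double C φ ≃* CosetFreeGroup C ⋊[cosetAut C] A :=
  MonoidHom.toMulEquiv (toSemidirect C φ) (ofSemidirect C φ)
    (ofSemidirect_comp_toSemidirect C φ) (toSemidirect_comp_ofSemidirect C φ)

end Double

end

/-- **Corollary.** The kernel `K` of the retraction `ψ` of the double `D = A ∗_{C = φ(C)} A`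
onto `A` (the identity on the first copy of `A`, `φ⁻¹` on the second copy) is a free group. -/
theorem double_kernel_free {A : Type*} [Group A] (C : Subgroup A) (φ : A ≃* A)
    (ψ : Double C φ →* A)
    (hinl : ∀ a : A, ψ (Double.inl C φ a) = a)
    (hinr : ∀ a : A, ψ (Double.inr C φ a) = φ.symm a) :
    IsFreeGroup ψ.ker := by
  have hψ : ψ = SemidirectProduct.rightHom.comp (Double.toSemidirect C φ) := by
    apply Double.hom_ext <;> intro a
    · simp [hinl, Double.toSemidirect_inl]
    · simp [hinr, Double.toSemidirect_inr, Double.twistedInr_apply]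
  let e := Double.equivSemidirect C φ
  have hker : (SemidirectProduct.inl (φ := Double.cosetAut C)).range.map
      e.symm.toMonoidHom = ψ.ker := by
    rw [SemidirectProduct.range_inl_eq_ker_rightHom, hψ, ← MonoidHom.comap_ker]
    exact Subgroup.map_equiv_eq_comap_symm e.symm _
  exact IsFreeGroup.ofMulEquiv
    ((MonoidHom.ofInjective SemidirectProduct.inl_injective).trans
      ((e.symm.subgroupMap _).trans (MulEquiv.subgroupCongr hker)))
end

section
/- Let A be a residually solvable group, C a subgroup of A that is solvably separable in A (i.e., the intersection over all natural numbers n of the sets C·δₙA equals C, where δₙA denotes the n-th term of the derived series of A), and φ : A → A a group automorphism. Then the double G = A ∗_{C = φ(C)} A of A over C via φ is residually solvable. -/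
open scoped Pointwise

theorem Group.isSolvable_pi_const {ι P : Type*} [Group P] [Group.IsSolvable P] :
    Group.IsSolvable (ι → P) := by
  obtain ⟨n, hn⟩ := Group.IsSolvable.solvable (G := P)
  refine ⟨n, (Subgroup.eq_bot_iff_forall _).2 fun f hf => funext fun i => ?_⟩
  have h := map_derivedSeries_le_derivedSeries (Pi.evalMonoidHom (fun _ : ι => P) i) n
    (Subgroup.mem_map_of_mem _ hf)
  rwa [hn, Subgroup.mem_bot] at h

theorem RegularWreathProduct.isSolvable {P S : Type*} [Group P] [Group S] [Group.IsSolvable P]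
    [Group.IsSolvable S] : Group.IsSolvable (P ≀ᵣ S) := by
  let ι : (S → P) →* P ≀ᵣ S :=
    { toFun := fun f => ⟨f, 1⟩
      map_one' := rfl
      map_mul' := fun f g => by ext <;> simp }
  have : Group.IsSolvable (S → P) := Group.isSolvable_pi_const
  exact Group.isSolvable_of_ker_le_range ι RegularWreathProduct.rightHom
    fun x hx => ⟨x.left, RegularWreathProduct.ext rfl (Eq.symm hx)⟩

/-- The group of invertible upper triangular matrices over the field with two elements. -/
def upperTriangularUnits (n : ℕ) : Subgroup (Matrix (Fin n) (Fin n) (ZMod 2))ˣ where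
  carrier := {u | (u : Matrix (Fin n) (Fin n) (ZMod 2)).IsUpperTriangular}
  one_mem' := Matrix.blockTriangular_one
  mul_mem' := fun ha hb => Matrix.BlockTriangular.mul ha hb
  inv_mem' := fun {u} hu => by
    let := u.invertible
    have h : Matrix.IsUpperTriangular _ := Matrix.blockTriangular_inv_of_blockTriangular hu
    simpa only [Set.mem_ofPred_eq, Matrix.coe_units_inv] using h

theorem isPGroup_upperTriangularUnits (n : ℕ) : IsPGroup 2 (upperTriangularUnits n) := by
  rintro ⟨u, hu⟩
  have hu' : (u : Matrix (Fin n) (Fin n) (ZMod 2)).IsUpperTriangular := hu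
  have hdiag : ∀ i, (u : Matrix (Fin n) (Fin n) (ZMod 2)) i i = 1 := fun i => by
    have hdet := ((Matrix.isUnit_iff_isUnit_det _).1 u.isUnit).ne_zero
    rw [Matrix.det_of_isUpperTriangular hu', Finset.prod_ne_zero_iff] at hdet
    exact (by decide : ∀ x : ZMod 2, x ≠ 0 → x = 1) _ (hdet i (Finset.mem_univ i))
  have hpow : ((u : Matrix (Fin n) (Fin n) (ZMod 2)) - 1) ^ n = 0 := by
    have h := Matrix.aeval_self_charpoly (u : Matrix (Fin n) (Fin n) (ZMod 2))
    rw [Matrix.charpoly_of_isUpperTriangular _ hu'] at h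
    simpa [hdiag] using h
  refine ⟨n, Subtype.ext (Units.ext ?_)⟩
  rcases isEmpty_or_nonempty (Fin n) with _ | _
  · exact Subsingleton.elim _ _
  have h : ((u : Matrix (Fin n) (Fin n) (ZMod 2)) - 1) ^ 2 ^ n = 0 :=
    pow_eq_zero_of_le Nat.lt_two_pow_self.le hpow
  rw [sub_pow_char_pow_of_commute (p := 2) _ (Commute.one_right _), one_pow, sub_eq_zero] at h
  simpa using h

/-- The matrix whose `(i, i + 1)` entry is `1` when the `i`-th entry of `l` is `y`, and whose other
entries vanish. -/
def superdiagonal {Y : Type*} [DecidableEq Y] (l : List Y) (y : Y) :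
    Matrix (Fin (l.length + 1)) (Fin (l.length + 1)) (ZMod 2) :=
  Matrix.of fun i j => if (j : ℕ) = i + 1 ∧ l[(i : ℕ)]? = some y then 1 else 0

section superdiagonal

variable {Y : Type*} [DecidableEq Y] {l : List Y}

theorem superdiagonal_mul_self (hl : l.IsChain (· ≠ ·)) (y : Y) :
    superdiagonal l y * superdiagonal l y = 0 := by
  ext i k
  rw [Matrix.mul_apply]
  refine Finset.sum_eq_zero fun j _ => ?_
  simp only [superdiagonal, Matrix.of_apply, ite_and, mul_ite, mul_one, mul_zero]
  split_ifs with h1 h2 h3 h4 <;> try rfl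
  rw [h3] at h2
  obtain ⟨hj, h2⟩ := List.getElem?_eq_some_iff.1 h2
  obtain ⟨hi, h4⟩ := List.getElem?_eq_some_iff.1 h4
  exact absurd (h4.trans h2.symm) (List.isChain_iff_getElem.1 hl i hj)

theorem one_add_superdiagonal_mul_self (hl : l.IsChain (· ≠ ·)) (y : Y) :
    (1 + superdiagonal l y) * (1 + superdiagonal l y) = 1 := by
  rw [mul_add, add_mul, add_mul, superdiagonal_mul_self hl, one_mul, mul_one, one_mul, add_zero,
    add_assoc, CharTwo.add_self_eq_zero, add_zero]

theorem isUpperTriangular_one_add_superdiagonal (y : Y) :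
    (1 + superdiagonal l y).IsUpperTriangular := by
  refine Matrix.blockTriangular_one.add fun i j hij => ?_
  have h : (j : ℕ) < i := hij
  exact if_neg fun h' => by omega

theorem one_add_superdiagonal_mul_apply (y : Y)
    (M : Matrix (Fin (l.length + 1)) (Fin (l.length + 1)) (ZMod 2))
    (i : ℕ) (hi : i < l.length) (k : Fin (l.length + 1)) :
    ((1 + superdiagonal l y) * M) ⟨i, by omega⟩ k =
      M ⟨i, by omega⟩ k + if l[i]? = some y then M ⟨i + 1, by omega⟩ k else 0 := by
  rw [add_mul, one_mul, Matrix.add_apply, Matrix.mul_apply,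
    Finset.sum_eq_single ⟨i + 1, by omega⟩]
  · simp [superdiagonal]
  · intro j _ hj
    have : (j : ℕ) ≠ i + 1 := fun h => hj (Fin.ext h)
    simp [superdiagonal, this]
  · simp

theorem prod_one_add_superdiagonal_apply_last (s pre : List Y) (h : pre ++ s = l) :
    (∀ i (hi : i < pre.length), (s.map fun y => 1 + superdiagonal l y).prod
      ⟨i, by subst h; simp; omega⟩ (Fin.last _) = 0) ∧
    (s.map fun y => 1 + superdiagonal l y).prod
      ⟨pre.length, by subst h; simp⟩ (Fin.last _) = 1 := by
  induction s generalizing pre with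
  | nil =>
    obtain rfl : pre = l := by simpa using h
    refine ⟨fun i hi => ?_, ?_⟩
    · exact Matrix.one_apply_ne fun h => hi.ne (congrArg Fin.val h)
    · exact Matrix.one_apply_eq _
  | cons y s ih =>
    obtain ⟨h0, h1⟩ := ih (pre ++ [y]) (by simpa using h)
    simp only [List.length_append, List.length_singleton] at h0 h1
    have hlen : pre.length < l.length := by subst h; simp
    have hget : l[pre.length]? = some y := by subst h; simp
    simp only [List.map_cons, List.prod_cons]
    refine ⟨fun i hi => ?_, ?_⟩
    · rw [one_add_superdiagonal_mul_apply y _ i (by omega), h0 i (by omega), h0 (i + 1) (by omega)]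
      simp
    · rw [one_add_superdiagonal_mul_apply y _ _ hlen, h0 _ (by omega), h1, if_pos hget, zero_add]

end superdiagonal

/-- In a free product of groups of order two, a reduced word survives in a solvable quotient. -/
theorem exists_isSolvable_involutions_prod_ne_one {Y : Type*} (l : List Y) (hne : l ≠ [])
    (hl : l.IsChain (· ≠ ·)) :
    ∃ (P : Type) (_ : Group P) (p : Y → P), Group.IsSolvable P ∧ (∀ y, p y * p y = 1) ∧
      (l.map p).prod ≠ 1 := by
  classical
  let u : Y → (Matrix (Fin (l.length + 1)) (Fin (l.length + 1)) (ZMod 2))ˣ := fun y =>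
    ⟨1 + superdiagonal l y, 1 + superdiagonal l y, one_add_superdiagonal_mul_self hl y,
      one_add_superdiagonal_mul_self hl y⟩
  let p : Y → upperTriangularUnits (l.length + 1) := fun y =>
    ⟨u y, isUpperTriangular_one_add_superdiagonal y⟩
  have : Group.IsNilpotent (upperTriangularUnits (l.length + 1)) :=
    (isPGroup_upperTriangularUnits (l.length + 1)).isNilpotent
  refine ⟨upperTriangularUnits (l.length + 1), inferInstance, p, inferInstance, fun y =>
    Subtype.ext (Units.ext (one_add_superdiagonal_mul_self hl y)), fun h => ?_⟩
  have h' := congrArg ((Units.coeHom _).comp (upperTriangularUnits (l.length + 1)).subtype) h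
  rw [map_list_prod, List.map_map, map_one] at h'
  have h1 := (prod_one_add_superdiagonal_apply_last (l := l) l [] rfl).2
  change (l.map fun y => 1 + superdiagonal l y).prod = 1 at h'
  rw [h', Matrix.one_apply_ne] at h1
  · exact zero_ne_one h1
  · exact fun h => hne (List.length_eq_zero_iff.1 (congrArg Fin.val h).symm)

namespace RegularWreathProduct

variable {P S : Type*} [Group P] [Group S]

/-- The conjugate of the standard embedding `S →* P ≀ᵣ S` by an element of the base group given by
a function on the cosets of `C`. -/
def conjInl {C : Subgroup S} (f : S ⧸ C → P) : S →* P ≀ᵣ S where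
  toFun s := ⟨fun t => f (t⁻¹ : S) * (f (t⁻¹ * s : S))⁻¹, s⟩
  map_one' := by ext <;> simp
  map_mul' a b := by ext <;> simp [mul_assoc]

theorem conjInl_of_mem {C : Subgroup S} (f : S ⧸ C → P) {s : S} (hs : s ∈ C) :
    conjInl f s = inl s := by
  refine RegularWreathProduct.ext (funext fun t => ?_) rfl
  change f (t⁻¹ : S) * (f (t⁻¹ * s : S))⁻¹ = 1
  rw [QuotientGroup.mk_mul_of_mem _ hs, mul_inv_cancel]

/-- The sequence of labelled cosets visited when the letters of a word are read one by one from
the starting point `u`. -/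
def cosetPath {ι : Type*} (C : Subgroup S) : S → List (ι × S) → List (ι × (S ⧸ C))
  | _, [] => []
  | u, x :: l => (x.1, (u : S ⧸ C)) :: (x.1, ((u * x.2 : S) : S ⧸ C)) :: cosetPath C (u * x.2) l

theorem isChain_cosetPath {ι : Type*} (C : Subgroup S) (l : List (ι × S)) (u : S)
    (hl : l.IsChain fun x y => x.1 ≠ y.1) (hC : ∀ x ∈ l, x.2 ∉ C) :
    (cosetPath C u l).IsChain (· ≠ ·) := by
  induction l generalizing u with
  | nil => exact List.isChain_nil
  | cons x l ih =>
    have hx : (x.1, (u : S ⧸ C)) ≠ (x.1, ((u * x.2 : S) : S ⧸ C)) := fun h =>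
      hC x List.mem_cons_self (by simpa [QuotientGroup.eq] using h)
    have ih' := ih (u * x.2) hl.tail fun y hy => hC y (List.mem_cons_of_mem _ hy)
    cases l with
    | nil => exact List.isChain_pair.2 hx
    | cons y l =>
      refine List.isChain_cons_cons.2 ⟨hx, List.isChain_cons_cons.2 ⟨fun h => ?_, ih'⟩⟩
      exact (List.isChain_cons_cons.1 hl).1 (Prod.ext_iff.1 h).1

theorem left_prod_conjInl {ι : Type*} {C : Subgroup S} (p : ι × (S ⧸ C) → P)
    (hp : ∀ y, p y * p y = 1) (l : List (ι × S)) (t : S) :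
    (l.map fun x => conjInl (fun y => p (x.1, y)) x.2).prod.left t =
      ((cosetPath C t⁻¹ l).map p).prod := by
  induction l generalizing t with
  | nil => rfl
  | cons x l ih =>
    have h := ih (x.2⁻¹ * t)
    rw [mul_inv_rev, inv_inv] at h
    rw [List.map_cons, List.prod_cons, mul_left, Pi.mul_apply]
    simp only [cosetPath, List.map_cons, List.prod_cons]
    rw [← h, ← mul_assoc, ← inv_eq_of_mul_eq_one_right (hp (x.1, ((t⁻¹ * x.2 : S) : S ⧸ C)))]
    rfl

end RegularWreathProduct

theorem exists_derivedSeries_notMem_map {A : Type*} [Group A] {C : Subgroup A}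
    (hsep : (⋂ n : ℕ, (C : Set A) * ((derivedSeries A n : Subgroup A) : Set A)) = (C : Set A))
    (l : List A) (hl : ∀ a ∈ l, a ∉ C) :
    ∃ n, ∀ a ∈ l, (a : A ⧸ derivedSeries A n) ∉ C.map (QuotientGroup.mk' (derivedSeries A n)) := by
  have key : ∀ a ∈ l, ∀ᶠ n in Filter.atTop,
      (a : A ⧸ derivedSeries A n) ∉ C.map (QuotientGroup.mk' (derivedSeries A n)) := by
    intro a ha
    have h : a ∉ ⋂ n : ℕ, (C : Set A) * ((derivedSeries A n : Subgroup A) : Set A) := by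
      rw [hsep]
      exact hl a ha
    obtain ⟨m, hm⟩ := not_forall.1 (mt Set.mem_iInter.2 h)
    filter_upwards [Filter.eventually_ge_atTop m] with n hn
    rintro ⟨c, hc, hca⟩
    exact hm (Set.mem_mul.2 ⟨c, hc, c⁻¹ * a, derivedSeries_antitone A hn (QuotientGroup.eq.1 hca),
      mul_inv_cancel_left c a⟩)
  exact ((Filter.eventually_all_finite l.finite_toSet).2 key).exists

theorem isSolvable_quotient_derivedSeries (A : Type*) [Group A] (n : ℕ) :
    Group.IsSolvable (A ⧸ derivedSeries A n) := by
  refine ⟨n, ?_⟩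
  rw [← map_derivedSeries_eq (QuotientGroup.mk'_surjective (derivedSeries A n)),
    QuotientGroup.map_mk'_self]

theorem Monoid.PushoutI.NormalWord.notMem_range {ι H : Type*} {G : ι → Type*}
    [∀ i, Group (G i)] [Group H] {φ : ∀ i, H →* G i} {d : NormalWord.Transversal φ}
    (w : NormalWord d) {x : Σ i, G i} (hx : x ∈ w.toList) : x.2 ∉ (φ x.1).range := by
  intro h
  have hu := ((d.compl x.1).existsUnique x.2).unique
    (y₁ := (⟨x.2, h⟩, ⟨1, d.one_mem x.1⟩)) (y₂ := (1, ⟨x.2, w.normalized x.1 x.2 hx⟩))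
    (mul_one _) (one_mul _)
  exact w.ne_one x hx (congrArg (fun y => (y.2 : G x.1)) hu).symm

namespace Double

variable {A : Type*} [Group A]

/-- The automorphism identifying `A` with each of the two copies of `A` in the double, in such a
way that its restriction to `C` is the amalgamating map. -/
def copyEquiv (φ : A ≃* A) : Bool → (A ≃* A)
  | false => MulEquiv.refl A
  | true => φ

variable {C : Subgroup A} {φ : A ≃* A}

theorem doubleMaps_apply (b : Bool) (c : C) : doubleMaps C φ b c = copyEquiv φ b c := by
  cases b <;> rfl

theorem copyEquiv_symm_doubleMaps (b : Bool) (c : C) :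
    (copyEquiv φ b).symm (doubleMaps C φ b c) = c := by
  rw [doubleMaps_apply, MulEquiv.symm_apply_apply]

theorem doubleMaps_injective (b : Bool) : Function.Injective (doubleMaps C φ b) := fun x y h =>
  Subtype.ext ((copyEquiv φ b).injective (by rwa [← doubleMaps_apply, ← doubleMaps_apply]))

/-- Two homomorphisms from `A` which agree on `C` induce a homomorphism from the double. -/
def lift {K : Type*} [Group K] (f : Bool → (A →* K)) (k : C →* K)
    (hf : ∀ b, ∀ c : C, f b c = k c) : Double C φ →* K :=
  Monoid.PushoutI.lift (fun b => (f b).comp (copyEquiv φ b).symm.toMonoidHom) k fun b =>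
    MonoidHom.ext fun c => by
      simpa [copyEquiv_symm_doubleMaps] using hf b c

theorem lift_base {K : Type*} [Group K] (f : Bool → (A →* K)) (k : C →* K)
    (hf : ∀ b, ∀ c : C, f b c = k c) (c : C) :
    lift (φ := φ) f k hf (Monoid.PushoutI.base (doubleMaps C φ) c) = k c :=
  Monoid.PushoutI.lift_base _ _ _ _

theorem lift_ofCoprodI_prod {K : Type*} [Group K] (f : Bool → (A →* K)) (k : C →* K)
    (hf : ∀ b, ∀ c : C, f b c = k c) (w : Monoid.CoprodI.Word fun _ : Bool => A) :
    lift (φ := φ) f k hf (Monoid.PushoutI.ofCoprodI w.prod) =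
      (w.toList.map fun x => f x.1 ((copyEquiv φ x.1).symm x.2)).prod := by
  rw [Monoid.CoprodI.Word.prod, map_list_prod, map_list_prod, List.map_map, List.map_map]
  simp [lift, Function.comp_def]

theorem exists_isSolvable_lift_ne_one
    (hsep : (⋂ n : ℕ, (C : Set A) * ((derivedSeries A n : Subgroup A) : Set A)) = (C : Set A))
    {d : Monoid.PushoutI.NormalWord.Transversal (doubleMaps C φ)}
    (w : Monoid.PushoutI.NormalWord d) (hw : w.toList ≠ []) :
    ∃ (n : ℕ) (P : Type) (_ : Group P) (f : Double C φ →* P ≀ᵣ (A ⧸ derivedSeries A n)),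
      Group.IsSolvable P ∧ f w.prod ≠ 1 := by
  obtain ⟨n, hn⟩ := exists_derivedSeries_notMem_map hsep
    (w.toList.map fun x => (copyEquiv φ x.1).symm x.2) (by
      intro a ha hC
      obtain ⟨x, hx, rfl⟩ := List.mem_map.1 ha
      refine w.notMem_range hx ⟨⟨_, hC⟩, ?_⟩
      rw [doubleMaps_apply, MulEquiv.apply_symm_apply])
  let q := QuotientGroup.mk' (derivedSeries A n)
  let D := C.map q
  let l : List (Bool × (A ⧸ derivedSeries A n)) :=
    w.toList.map fun x => (x.1, q ((copyEquiv φ x.1).symm x.2))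
  have hchain : (RegularWreathProduct.cosetPath D 1 l).IsChain (· ≠ ·) := by
    refine RegularWreathProduct.isChain_cosetPath D l 1 ?_ fun x hx => ?_
    · rw [List.isChain_map]
      exact w.chain_ne
    · obtain ⟨y, hy, rfl⟩ := List.mem_map.1 hx
      exact hn _ (List.mem_map_of_mem hy)
  have hne : RegularWreathProduct.cosetPath D 1 l ≠ [] := by
    cases hl : l with
    | nil => exact absurd (List.map_eq_nil_iff.1 hl) hw
    | cons x l => exact List.cons_ne_nil _ _
  obtain ⟨P, hP, p, hsol, hp, hprod⟩ :=
    exists_isSolvable_involutions_prod_ne_one _ hne hchain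
  let f : Double C φ →* P ≀ᵣ (A ⧸ derivedSeries A n) :=
    lift (fun b => (RegularWreathProduct.conjInl fun y : _ ⧸ D => p (b, y)).comp q)
      ((RegularWreathProduct.inl.comp q).comp C.subtype) fun b c =>
        RegularWreathProduct.conjInl_of_mem (fun y : _ ⧸ D => p (b, y))
          (Subgroup.mem_map_of_mem q c.2)
  have hbase : f (Monoid.PushoutI.base (doubleMaps C φ) w.head) =
      RegularWreathProduct.inl (q w.head) := lift_base _ _ _ _
  have hword : f (Monoid.PushoutI.ofCoprodI w.toWord.prod) =
      (l.map fun x => RegularWreathProduct.conjInl (fun y => p (x.1, y)) x.2).prod := by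
    rw [List.map_map]
    exact lift_ofCoprodI_prod _ _ _ _
  refine ⟨n, P, hP, f, hsol, fun h => hprod ?_⟩
  rw [Monoid.PushoutI.NormalWord.prod, map_mul, hbase, hword, mul_eq_one_iff_inv_eq,
    ← map_inv] at h
  have hleft := RegularWreathProduct.left_prod_conjInl p hp l 1
  rw [inv_one, ← h] at hleft
  exact hleft.symm

end Double

/-- **Theorem (RS_solubly_sepr).** If `A` is residually solvable and `C` is solvably separable
in `A` (i.e. `⋂ n, C·δₙA = C` where `δₙA` is the derived series of `A`), then the double
`G = A ∗_{C = φ(C)} A` is residually solvable. -/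
theorem double_residually_solvable_of_solvably_separable {A : Type u} [Group A]
    (hA : ResiduallySolvable A) (C : Subgroup A)
    (hsep : (⋂ n : ℕ, (C : Set A) * ((derivedSeries A n : Subgroup A) : Set A)) = (C : Set A))
    (φ : A ≃* A) :
    ResiduallySolvable (Double C φ) := by
  intro g hg
  obtain ⟨d⟩ := Monoid.PushoutI.NormalWord.transversal_nonempty (doubleMaps C φ)
    Double.doubleMaps_injective
  classical
  obtain ⟨w, rfl⟩ := (Monoid.PushoutI.NormalWord.equiv (d := d)).symm.surjective g
  change w.prod ≠ 1 at hg
  change ∃ (S : Type _) (_ : Group S) (f : Double C φ →* S), IsSolvable S ∧ f w.prod ≠ 1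
  by_cases hw : w.toList = []
  · have hprod : w.prod = Monoid.PushoutI.base (doubleMaps C φ) w.head := by
      simp [Monoid.PushoutI.NormalWord.prod, Monoid.CoprodI.Word.prod, hw]
    rw [hprod] at hg ⊢
    obtain ⟨S, _, f, hS, hf⟩ := hA w.head fun h => hg (by rw [OneMemClass.coe_eq_one.1 h, map_one])
    refine ⟨S, inferInstance, Double.lift (fun _ => f) (f.comp C.subtype) fun _ _ => rfl, hS,
      fun h => hf ?_⟩
    exact (Double.lift_base (fun _ => f) (f.comp C.subtype) (fun _ _ => rfl) w.head).symm.trans h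
  · obtain ⟨n, P, _, f, _, hf⟩ := Double.exists_isSolvable_lift_ne_one hsep w hw
    have := isSolvable_quotient_derivedSeries A n
    exact ⟨_, inferInstance, f, RegularWreathProduct.isSolvable, hf⟩
end
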